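/- For all n, k ∈ ℕ with k ≤ n, one has the closed forms E_{n,k}(−1, 2; 1) = n! · C(n+1, 2k) and E_{n,k}(−1, 2; 2) = n! · C(n+1, 2k+1), where C(·,·) denotes binomial coefficients (equal to 0 when the lower index exceeds n+1); the identities are between complex numbers. -/

import Mathlib

/-- Falling factorial with stride `α`: `(r)^{\underline{m},α} = ∏_{i=0}^{m-1} (r - iα)`. -/
noncomputable def ffall (r α : ℂ) (m : ℕ) : ℂ := ∏ i ∈ Finset.range m, (r - i * α)

/-- Modified generalized Stirling numbers
`Ŝ_{n,k}(α,β;r) = Σ_{x=0}^{k} (−1)^{k−x} C(k,x) (βx+r)^{\underline{n},α}`. -/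
noncomputable def Shat (α β r : ℂ) (n k : ℕ) : ℂ :=
  ∑ x ∈ Finset.range (k + 1), (-1) ^ (k - x) * (Nat.choose k x : ℂ) * ffall (β * x + r) α n

/-- Generalized Eulerian numbers
`E_{n,k}(α,β;r) = Σ_{x=0}^{k} (−1)^{k−x} C(n+1,k−x) (βx+r)^{\underline{n},α}`. -/
noncomputable def Egen (α β r : ℂ) (n k : ℕ) : ℂ :=
  ∑ x ∈ Finset.range (k + 1), (-1) ^ (k - x) * (Nat.choose (n + 1) (k - x) : ℂ) * ffall (β * x + r) α n

open PowerSeries in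
/-- The coefficient of `X ^ (2 * k + s)`, `s < 2`, in
`(1 - X ^ 2) ^ (n + 1) * (1 - X) ^ (-(n + 1)) = (1 + X) ^ (n + 1)`. -/
theorem sum_neg_one_pow_mul_choose_mul_choose (n k s : ℕ) (hk : k ≤ n) (hs : s < 2) :
    ∑ y ∈ Finset.range (k + 1), (-1 : ℂ) ^ y * ((n + 1).choose y : ℂ) *
      ((n + (2 * (k - y) + s)).choose n : ℂ) = ((n + 1).choose (2 * k + s) : ℂ) := by
  have hgeom : (mk 1 : ℂ⟦X⟧) * (1 - X) = 1 := mk_one_mul_one_sub_eq_one ℂ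
  have hseries : (1 - (X : ℂ⟦X⟧) ^ 2) ^ (n + 1) * (mk fun j => ((n + j).choose n : ℂ)) =
      (1 + X) ^ (n + 1) := by
    rw [← mk_one_pow_eq_mk_choose_add, ← mul_pow]
    congr 1
    linear_combination (1 + X) * hgeom
  have hexpand : (1 - (X : ℂ⟦X⟧) ^ 2) ^ (n + 1) =
      ∑ y ∈ Finset.range (n + 2), C ((-1 : ℂ) ^ y * ((n + 1).choose y : ℂ)) * X ^ (2 * y) := by
    rw [sub_eq_neg_add, add_pow]
    refine Finset.sum_congr rfl fun y _ => ?_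
    rw [neg_pow, ← pow_mul]
    simp only [map_mul, map_pow, map_neg, map_one, map_natCast, one_pow]
    ring
  have hright : coeff (2 * k + s) ((1 + (X : ℂ⟦X⟧)) ^ (n + 1)) =
      ((n + 1).choose (2 * k + s) : ℂ) := by
    have hcoe : (1 + (X : ℂ⟦X⟧)) ^ (n + 1) =
        (((1 + Polynomial.X) ^ (n + 1) : Polynomial ℂ) : ℂ⟦X⟧) := by simp
    rw [hcoe, Polynomial.coeff_coe, Polynomial.coeff_one_add_X_pow]
  rw [← hright, ← hseries, hexpand, Finset.sum_mul, map_sum]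
  have hsub : Finset.range (k + 1) ⊆ Finset.range (n + 2) :=
    Finset.range_subset_range.2 (by omega)
  rw [← Finset.sum_subset hsub]
  · refine Finset.sum_congr rfl fun y hy => ?_
    have hy' := Finset.mem_range.1 hy
    rw [mul_assoc (C _), coeff_C_mul, coeff_X_pow_mul', if_pos (by omega), coeff_mk,
      show 2 * k + s - 2 * y = 2 * (k - y) + s by omega]
  · intro y _ hy
    have hy' := mt Finset.mem_range.2 hy
    rw [mul_assoc (C _), coeff_C_mul, coeff_X_pow_mul', if_neg (by omega), mul_zero]

/-- With stride `-1` the falling factorial is a rising factorial. -/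
theorem ffall_neg_one_natCast_succ (m n : ℕ) :
    ffall ((m + 1 : ℕ) : ℂ) (-1) n = (n.factorial : ℂ) * ((n + m).choose n : ℂ) := by
  have h : ffall ((m + 1 : ℕ) : ℂ) (-1) n = ((m + 1).ascFactorial n : ℂ) := by
    rw [ffall, Nat.ascFactorial_eq_prod_range, Nat.cast_prod]
    refine Finset.prod_congr rfl fun i _ => ?_
    push_cast
    ring
  rw [h, Nat.ascFactorial_eq_factorial_mul_choose, Nat.cast_mul, add_comm n m]

theorem Egen_neg_one_two_natCast_succ (n k s : ℕ) (hk : k ≤ n) (hs : s < 2) :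
    Egen (-1) 2 ((s + 1 : ℕ) : ℂ) n k =
      (n.factorial : ℂ) * ((n + 1).choose (2 * k + s) : ℂ) := by
  rw [← sum_neg_one_pow_mul_choose_mul_choose n k s hk hs, Finset.mul_sum, Egen,
    ← Finset.sum_range_reflect]
  refine Finset.sum_congr rfl fun y hy => ?_
  have hy' := Finset.mem_range.1 hy
  rw [show k + 1 - 1 - y = k - y by omega, show k - (k - y) = y by omega,
    show (2 : ℂ) * ((k - y : ℕ) : ℂ) + ((s + 1 : ℕ) : ℂ) = ((2 * (k - y) + s + 1 : ℕ) : ℂ) by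
      push_cast; ring,
    ffall_neg_one_natCast_succ]
  ring

/-- Closed forms: `E_{n,k}(−1, 2; 1) = n! C(n+1, 2k)` and
`E_{n,k}(−1, 2; 2) = n! C(n+1, 2k+1)`. -/
theorem Egen_neg_one_two (n k : ℕ) (hk : k ≤ n) :
    Egen (-1) 2 1 n k = (Nat.factorial n : ℂ) * (Nat.choose (n + 1) (2 * k) : ℂ) ∧
    Egen (-1) 2 2 n k = (Nat.factorial n : ℂ) * (Nat.choose (n + 1) (2 * k + 1) : ℂ) := by
  constructor
  · simpa using Egen_neg_one_two_natCast_succ n k 0 hk (by norm_num)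
  · simpa using Egen_neg_one_two_natCast_succ n k 1 hk (by norm_num)
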